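/- Let β ∈ K with β ≠ 0 be such that the plane sextic C : X⁶ + Y⁵Z + YZ⁵ + βX²Y²Z² = 0 is smooth. Then Aut(C) ⊂ PGL₃(K) equals the subgroup generated by σ = diag(1, ζ₈, ζ₈³) and τ = [X:Z:Y]; it has order 16 and satisfies σ⁸ = τ² = 1 and τστ = σ³, i.e., Aut(C) is the semidihedral (quasidihedral) group SD₁₆ of order 16. -/

import Mathlib

open MvPolynomial

/-- `GL₃(K)`: the group of invertible `3 × 3` matrices over `K`. -/
abbrev GL3 (K : Type*) [Field K] := (Matrix (Fin 3) (Fin 3) K)ˣ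

/-- `PGL₃(K)`: the quotient of `GL₃(K)` by its center (the scalar matrices). -/
abbrev PGL3 (K : Type*) [Field K] := GL3 K ⧸ Subgroup.center (GL3 K)

variable {K : Type*} [Field K]

/-- The substitution `F(X,Y,Z) ↦ F(A·(X,Y,Z)ᵗ)` for a `3 × 3` matrix `A`. -/
noncomputable def matAct (A : Matrix (Fin 3) (Fin 3) K) (F : MvPolynomial (Fin 3) K) :
    MvPolynomial (Fin 3) K :=
  aeval (fun i => ∑ j, C (A i j) * X j) F

lemma matAct_one (F : MvPolynomial (Fin 3) K) : matAct 1 F = F := by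
  unfold matAct
  have h : (fun i => ∑ j, C ((1 : Matrix (Fin 3) (Fin 3) K) i j) * X j)
      = (X : Fin 3 → MvPolynomial (Fin 3) K) := by
    funext i
    rw [Finset.sum_eq_single i]
    · simp
    · intro b _ hb
      simp [Matrix.one_apply, Ne.symm hb]
    · simp
  rw [h, aeval_X_left_apply]

lemma matAct_matAct (A B : Matrix (Fin 3) (Fin 3) K) (F : MvPolynomial (Fin 3) K) :
    matAct B (matAct A F) = matAct (A * B) F := by
  unfold matAct
  rw [← AlgHom.comp_apply, comp_aeval]
  have h : (fun i => (aeval fun i => ∑ j, C (B i j) * X j) (∑ j, C (A i j) * X j))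
      = fun i => ∑ j : Fin 3, C ((A * B) i j) * (X j : MvPolynomial (Fin 3) K) := by
    funext i
    simp only [map_sum, map_mul, aeval_C, aeval_X, algebraMap_eq, Finset.mul_sum]
    rw [Finset.sum_comm]
    refine Finset.sum_congr rfl fun k _ => ?_
    rw [Matrix.mul_apply, map_sum, Finset.sum_mul]
    refine Finset.sum_congr rfl fun j _ => ?_
    rw [map_mul, mul_assoc]
  rw [h]

lemma matAct_smul (A : Matrix (Fin 3) (Fin 3) K) (c : K) (F : MvPolynomial (Fin 3) K) :
    matAct A (c • F) = c • matAct A F :=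
  map_smul (aeval fun i => ∑ j, C (A i j) * X j) c F

/-- The class of a matrix `A` in `PGL₃(K)` (junk value `1` if `A` is not invertible). -/
noncomputable def pgl (A : Matrix (Fin 3) (Fin 3) K) : PGL3 K := by
  classical
  exact if h : IsUnit A then (QuotientGroup.mk h.unit : PGL3 K) else 1

/-- `F` defines a smooth plane sextic: `F` is homogeneous of degree `6`, and `F` together with
its partial derivatives have no common zero besides the origin. -/
def IsSmoothSextic (F : MvPolynomial (Fin 3) K) : Prop :=
  F.IsHomogeneous 6 ∧
    ∀ p : Fin 3 → K, eval p F = 0 → (∀ i, eval p (pderiv i F) = 0) → p = 0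

/-- The automorphism group of the plane curve `F = 0`: the subgroup of `PGL₃(K)` consisting of
the classes of matrices `A ∈ GL₃(K)` with `F(A·(X,Y,Z)ᵗ) = λ·F(X,Y,Z)` for some `λ ∈ K×`. -/
noncomputable def planeAut (F : MvPolynomial (Fin 3) K) : Subgroup (PGL3 K) where
  carrier := {g | ∃ A : GL3 K, (QuotientGroup.mk A : PGL3 K) = g ∧
    ∃ c : K, c ≠ 0 ∧ matAct (A : Matrix (Fin 3) (Fin 3) K) F = c • F}
  one_mem' := ⟨1, rfl, 1, one_ne_zero, by rw [Units.val_one, matAct_one, one_smul]⟩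
  mul_mem' := by
    rintro g h ⟨A, rfl, c, hc, hA⟩ ⟨B, rfl, d, hd, hB⟩
    exact ⟨A * B, rfl, c * d, mul_ne_zero hc hd, by
      rw [Units.val_mul, ← matAct_matAct, hA, matAct_smul, hB, smul_smul]⟩
  inv_mem' := by
    rintro g ⟨A, rfl, c, hc, hA⟩
    refine ⟨A⁻¹, rfl, c⁻¹, inv_ne_zero hc, ?_⟩
    rw [eq_inv_smul_iff₀ hc, ← matAct_smul, ← hA, matAct_matAct, ← Units.val_mul,
      mul_inv_cancel, Units.val_one, matAct_one]

/-- The directional derivative of polynomials along the vector `v`. -/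
noncomputable def dirDeriv (v : Fin 3 → K) :
    Derivation K (MvPolynomial (Fin 3) K) (MvPolynomial (Fin 3) K) :=
  mkDerivation K fun i => C (v i)

lemma dirDeriv_X (v : Fin 3 → K) (i : Fin 3) : dirDeriv v (X i) = C (v i) :=
  mkDerivation_X _ _ _

lemma dirDeriv_C (v : Fin 3 → K) (d : K) : dirDeriv v (C d) = 0 :=
  (dirDeriv v).map_algebraMap d

lemma pderiv_matAct (A : Matrix (Fin 3) (Fin 3) K) (j : Fin 3) (F : MvPolynomial (Fin 3) K) :
    pderiv j (matAct A F) = matAct A (dirDeriv (fun i => A i j) F) := by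
  unfold matAct
  induction F using MvPolynomial.induction_on with
  | C a =>
    simp
  | add p q hp hq => simp only [map_add, hp, hq]
  | mul_X p i hp =>
    simp only [map_mul, Derivation.leibniz, smul_eq_mul, map_add, hp, dirDeriv_X, aeval_X, aeval_C,
      map_sum, pderiv_C, pderiv_X, algebraMap_eq]
    simp [Pi.single_apply]

lemma derivation_ofNat (D : Derivation K (MvPolynomial (Fin 3) K) (MvPolynomial (Fin 3) K))
    (n : ℕ) [n.AtLeastTwo] : D ofNat(n) = 0 :=
  D.map_natCast n

/-- If `X ↦ A X` fixes the curve `X⁶ + Y⁵Z + YZ⁵ + βX²Y²Z² = 0`, it preserves the space of cubic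
operators apolar to it, hence carries `15 ∂x²∂y - β ∂z³` to an apolar operator. -/
lemma apolar_dirDeriv {β c : K} (A : GL3 K)
    (h : matAct (A : Matrix (Fin 3) (Fin 3) K) (X 0 ^ 6 + X 1 ^ 5 * X 2 + X 1 * X 2 ^ 5
        + C β * X 0 ^ 2 * X 1 ^ 2 * X 2 ^ 2)
      = c • (X 0 ^ 6 + X 1 ^ 5 * X 2 + X 1 * X 2 ^ 5 + C β * X 0 ^ 2 * X 1 ^ 2 * X 2 ^ 2)) :
    (15 : K) • dirDeriv (fun i => A.1 i 0) (dirDeriv (fun i => A.1 i 0) (dirDeriv (fun i => A.1 i 1)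
        (X 0 ^ 6 + X 1 ^ 5 * X 2 + X 1 * X 2 ^ 5 + C β * X 0 ^ 2 * X 1 ^ 2 * X 2 ^ 2)))
      - β • dirDeriv (fun i => A.1 i 2) (dirDeriv (fun i => A.1 i 2) (dirDeriv (fun i => A.1 i 2)
        (X 0 ^ 6 + X 1 ^ 5 * X 2 + X 1 * X 2 ^ 5 + C β * X 0 ^ 2 * X 1 ^ 2 * X 2 ^ 2))) = 0 := by
  have hinj : Function.Injective (matAct (A : Matrix (Fin 3) (Fin 3) K)) := by
    refine Function.LeftInverse.injective (g := matAct (A⁻¹ : GL3 K).1) fun F => ?_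
    rw [matAct_matAct, ← Units.val_mul, mul_inv_cancel, Units.val_one, matAct_one]
  apply hinj
  have hsub : ∀ F G, matAct A.1 (F - G) = matAct A.1 F - matAct A.1 G := map_sub (aeval _)
  have h0 : matAct A.1 0 = 0 := map_zero (aeval _)
  rw [hsub, h0, matAct_smul, matAct_smul, ← pderiv_matAct, ← pderiv_matAct, ← pderiv_matAct,
    ← pderiv_matAct, ← pderiv_matAct, ← pderiv_matAct, h]
  have h10 : (1 : Fin 3) ≠ 0 := by decide
  have h20 : (2 : Fin 3) ≠ 0 := by decide
  have h21 : (2 : Fin 3) ≠ 1 := by decide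
  simp only [smul_eq_C_mul, Derivation.leibniz, Derivation.leibniz_pow, pderiv_X_self, map_add,
    map_zero, Derivation.map_one_eq_zero, pderiv_X_of_ne h10, pderiv_X_of_ne h20,
    pderiv_X_of_ne h21, pderiv_X_of_ne h10.symm, pderiv_X_of_ne h20.symm, pderiv_X_of_ne h21.symm,
    pderiv_C, smul_eq_mul, nsmul_eq_mul, Nat.cast_ofNat, derivation_ofNat, map_ofNat C,
    Derivation.map_natCast]

  norm_num
  ring

lemma eq_zero_of_cubic_eval_eq_zero [CharZero K] {β p q r s t u m n : K} (hβ : β ≠ 0)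
    (h : ∀ x y z : K, 120 * p * x ^ 3 + q * (20 * y ^ 3 + 4 * β * x ^ 2 * z)
      + r * (20 * z ^ 3 + 4 * β * x ^ 2 * y) + s * (4 * β * x * z ^ 2) + t * (4 * β * x * y ^ 2)
      + u * (8 * β * x * y * z) + m * (y * z ^ 2) + n * (y ^ 2 * z) = 0) :
    p = 0 ∧ q = 0 ∧ r = 0 ∧ s = 0 ∧ t = 0 ∧ u = 0 ∧ m = 0 ∧ n = 0 := by
  have hp : p = 0 := by linear_combination h 1 0 0 / 120
  have hq : q = 0 := by linear_combination h 0 1 0 / 20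
  have hr : r = 0 := by linear_combination h 0 0 1 / 20
  have hm : m = 0 := by
    linear_combination h 0 1 1 / 2 + h 0 1 (-1) / 2 - 20 * hq
  have hn : n = 0 := by
    linear_combination h 0 1 1 - 20 * hq - 20 * hr - hm
  subst hp hq hr hm hn
  have hs : s = 0 := by
    have : (4 * β) * s = 0 := by linear_combination h 1 0 1
    simpa [hβ] using this
  have ht : t = 0 := by
    have : (4 * β) * t = 0 := by linear_combination h 1 1 0
    simpa [hβ] using this
  subst hs ht
  have hu : u = 0 := by
    have : (8 * β) * u = 0 := by linear_combination h 1 1 1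
    simpa [hβ] using this
  simp [hu]

/-- The coefficientwise form of `apolar_dirDeriv`: the coefficients of the cubic
`15 a²b - β c³`, where `a`, `b`, `c` are the columns of the matrix. -/
lemma cubic_coeffs_of_apolar [CharZero K] {β a₀ a₁ a₂ b₀ b₁ b₂ c₀ c₁ c₂ : K} (hβ : β ≠ 0)
    {u v w : Fin 3 → K} (hu : u = ![a₀, a₁, a₂]) (hv : v = ![b₀, b₁, b₂]) (hw : w = ![c₀, c₁, c₂])
    (h : (15 : K) • dirDeriv u (dirDeriv u (dirDeriv v
        (X 0 ^ 6 + X 1 ^ 5 * X 2 + X 1 * X 2 ^ 5 + C β * X 0 ^ 2 * X 1 ^ 2 * X 2 ^ 2)))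
      - β • dirDeriv w (dirDeriv w (dirDeriv w
        (X 0 ^ 6 + X 1 ^ 5 * X 2 + X 1 * X 2 ^ 5 + C β * X 0 ^ 2 * X 1 ^ 2 * X 2 ^ 2))) = 0) :
    15 * (a₀ ^ 2 * b₀) = β * c₀ ^ 3 ∧
    15 * (a₁ ^ 2 * b₂ + 2 * a₁ * a₂ * b₁) = β * (3 * c₁ ^ 2 * c₂) ∧
    15 * (a₂ ^ 2 * b₁ + 2 * a₁ * a₂ * b₂) = β * (3 * c₁ * c₂ ^ 2) ∧
    15 * (a₁ ^ 2 * b₀ + 2 * a₀ * a₁ * b₁) = β * (3 * c₀ * c₁ ^ 2) ∧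
    15 * (a₂ ^ 2 * b₀ + 2 * a₀ * a₂ * b₂) = β * (3 * c₀ * c₂ ^ 2) ∧
    15 * (2 * a₀ * a₁ * b₂ + 2 * a₀ * a₂ * b₁ + 2 * a₁ * a₂ * b₀) = β * (6 * c₀ * c₁ * c₂) ∧
    15 * (15 * (a₂ ^ 2 * b₂) - β * c₂ ^ 3)
      = - β * (15 * (a₀ ^ 2 * b₁ + 2 * a₀ * a₁ * b₀) - β * (3 * c₀ ^ 2 * c₁)) ∧
    15 * (15 * (a₁ ^ 2 * b₁) - β * c₁ ^ 3)
      = - β * (15 * (a₀ ^ 2 * b₂ + 2 * a₀ * a₂ * b₀) - β * (3 * c₀ ^ 2 * c₂)) := by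
  have hE : ∀ x y z : K,
      120 * (15 * (a₀ ^ 2 * b₀) - β * c₀ ^ 3) * x ^ 3
      + (15 * (a₁ ^ 2 * b₂ + 2 * a₁ * a₂ * b₁) - β * (3 * c₁ ^ 2 * c₂))
          * (20 * y ^ 3 + 4 * β * x ^ 2 * z)
      + (15 * (a₂ ^ 2 * b₁ + 2 * a₁ * a₂ * b₂) - β * (3 * c₁ * c₂ ^ 2))
          * (20 * z ^ 3 + 4 * β * x ^ 2 * y)
      + (15 * (a₁ ^ 2 * b₀ + 2 * a₀ * a₁ * b₁) - β * (3 * c₀ * c₁ ^ 2)) * (4 * β * x * z ^ 2)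
      + (15 * (a₂ ^ 2 * b₀ + 2 * a₀ * a₂ * b₂) - β * (3 * c₀ * c₂ ^ 2)) * (4 * β * x * y ^ 2)
      + (15 * (2 * a₀ * a₁ * b₂ + 2 * a₀ * a₂ * b₁ + 2 * a₁ * a₂ * b₀) - β * (6 * c₀ * c₁ * c₂))
          * (8 * β * x * y * z)
      + (60 * (15 * (a₂ ^ 2 * b₂) - β * c₂ ^ 3)
          + 4 * β * (15 * (a₀ ^ 2 * b₁ + 2 * a₀ * a₁ * b₀) - β * (3 * c₀ ^ 2 * c₁))) * (y * z ^ 2)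
      + (60 * (15 * (a₁ ^ 2 * b₁) - β * c₁ ^ 3)
          + 4 * β * (15 * (a₀ ^ 2 * b₂ + 2 * a₀ * a₂ * b₀) - β * (3 * c₀ ^ 2 * c₂))) * (y ^ 2 * z)
      = 0 := by
    intro x y z
    have := congrArg (eval ![x, y, z]) h
    subst hu hv hw
    simp only [map_sub, map_add, Derivation.leibniz, Derivation.leibniz_pow, dirDeriv_X, dirDeriv_C,
      smul_eq_mul, smul_eq_C_mul, nsmul_eq_mul, Nat.cast_ofNat, derivation_ofNat, map_mul, map_zero,
      map_pow, map_ofNat, eval_X, eval_C, Matrix.cons_val,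
      Derivation.map_natCast] at this
    norm_num at this
    linear_combination this
  have key := eq_zero_of_cubic_eval_eq_zero hβ hE
  refine ⟨?_, ?_, ?_, ?_, ?_, ?_, ?_, ?_⟩
  · linear_combination key.1
  · linear_combination key.2.1
  · linear_combination key.2.2.1
  · linear_combination key.2.2.2.1
  · linear_combination key.2.2.2.2.1
  · linear_combination key.2.2.2.2.2.1
  · linear_combination key.2.2.2.2.2.2.1 / 4
  · linear_combination key.2.2.2.2.2.2.2 / 4

/-- A triple of linear forms `a`, `b`, `c` such that the cubic `15 a²b - β c³` lies in the pencil
spanned by `15 x²y - β z³` and `15 x²z - β y³` consists of multiples of the coordinates: compare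
the cusps of the members of the pencil. The vector `p` is the cusp of `15 a²b - β c³`. -/
lemma monomial_of_cubic_coeffs [CharZero K] {β a₀ a₁ a₂ b₀ b₁ b₂ c₀ c₁ c₂ p₀ p₁ p₂ : K}
    (hβ : β ≠ 0) (ha : ¬ (a₀ = 0 ∧ a₁ = 0 ∧ a₂ = 0))
    (hap : a₀ * p₀ + a₁ * p₁ + a₂ * p₂ = 0) (hbp : b₀ * p₀ + b₁ * p₁ + b₂ * p₂ = 1)
    (hcp : c₀ * p₀ + c₁ * p₁ + c₂ * p₂ = 0)
    (h : 15 * (a₀ ^ 2 * b₀) = β * c₀ ^ 3 ∧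
      15 * (a₁ ^ 2 * b₂ + 2 * a₁ * a₂ * b₁) = β * (3 * c₁ ^ 2 * c₂) ∧
      15 * (a₂ ^ 2 * b₁ + 2 * a₁ * a₂ * b₂) = β * (3 * c₁ * c₂ ^ 2) ∧
      15 * (a₁ ^ 2 * b₀ + 2 * a₀ * a₁ * b₁) = β * (3 * c₀ * c₁ ^ 2) ∧
      15 * (a₂ ^ 2 * b₀ + 2 * a₀ * a₂ * b₂) = β * (3 * c₀ * c₂ ^ 2) ∧
      15 * (2 * a₀ * a₁ * b₂ + 2 * a₀ * a₂ * b₁ + 2 * a₁ * a₂ * b₀) = β * (6 * c₀ * c₁ * c₂) ∧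
      15 * (15 * (a₂ ^ 2 * b₂) - β * c₂ ^ 3)
        = - β * (15 * (a₀ ^ 2 * b₁ + 2 * a₀ * a₁ * b₀) - β * (3 * c₀ ^ 2 * c₁)) ∧
      15 * (15 * (a₁ ^ 2 * b₁) - β * c₁ ^ 3)
        = - β * (15 * (a₀ ^ 2 * b₂ + 2 * a₀ * a₂ * b₀) - β * (3 * c₀ ^ 2 * c₂))) :
    a₁ = 0 ∧ a₂ = 0 ∧ b₀ = 0 ∧ c₀ = 0 ∧ ((b₂ = 0 ∧ c₁ = 0) ∨ (b₁ = 0 ∧ c₂ = 0)) := by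
  obtain ⟨hxxx, hyyz, hyzz, hxyy, hxzz, hxyz, hzzz, hyyy⟩ := h
  obtain ⟨s, hs⟩ : ∃ s, s = 15 * (a₀ ^ 2 * b₁ + 2 * a₀ * a₁ * b₀) - β * (3 * c₀ ^ 2 * c₁) :=
    ⟨_, rfl⟩
  obtain ⟨t, ht⟩ : ∃ t, t = 15 * (a₀ ^ 2 * b₂ + 2 * a₀ * a₂ * b₀) - β * (3 * c₀ ^ 2 * c₂) :=
    ⟨_, rfl⟩
  rw [← hs] at hzzz
  rw [← ht] at hyyy
  have dxx : s * p₁ + t * p₂ = 15 * a₀ ^ 2 := by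
    linear_combination p₁ * hs + p₂ * ht - 3 * p₀ * hxxx + 30 * a₀ * b₀ * hap + 15 * a₀ ^ 2 * hbp
      - 3 * β * c₀ ^ 2 * hcp
  have dxy : s * p₀ = 15 * a₀ * a₁ := by
    linear_combination p₀ * hs - p₁ * hxyy - p₂ * hxyz / 2 + 15 * (a₀ * b₁ + a₁ * b₀) * hap
      + 15 * a₀ * a₁ * hbp - 3 * β * c₀ * c₁ * hcp
  have dxz : t * p₀ = 15 * a₀ * a₂ := by
    linear_combination p₀ * ht - p₂ * hxzz - p₁ * hxyz / 2 + 15 * (a₀ * b₂ + a₂ * b₀) * hap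
      + 15 * a₀ * a₂ * hbp - 3 * β * c₀ * c₂ * hcp
  have dyz : a₁ * a₂ = 0 := by
    linear_combination (p₀ * hxyz / 2 + p₁ * hyyz + p₂ * hyzz - 15 * (a₁ * b₂ + a₂ * b₁) * hap
      - 15 * a₁ * a₂ * hbp + 3 * β * c₁ * c₂ * hcp) / 15
  have dyy : -β * (t * p₁) = 75 * a₁ ^ 2 := by
    linear_combination -p₁ * hyyy - 5 * p₂ * hyyz - 5 * p₀ * hxyy + 150 * a₁ * b₁ * hap
      + 75 * a₁ ^ 2 * hbp - 15 * β * c₁ ^ 2 * hcp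
  have dzz : -β * (s * p₂) = 75 * a₂ ^ 2 := by
    linear_combination -p₂ * hzzz - 5 * p₁ * hyzz - 5 * p₀ * hxzz + 150 * a₂ * b₂ * hap
      + 75 * a₂ ^ 2 * hbp - 15 * β * c₂ ^ 2 * hcp
  have ha12 : a₁ = 0 ∧ a₂ = 0 := by
    rcases mul_eq_zero.mp dyz with h1 | h2
    · refine ⟨h1, by_contra fun h2 => ?_⟩
      have hsp : s * p₂ ≠ 0 := fun h0 => by simp [h0, h2] at dzz
      have hs0 := left_ne_zero_of_mul hsp
      have hp2 := right_ne_zero_of_mul hsp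
      have hp0 : p₀ = 0 := by simpa [h1, hs0] using dxy
      simp [h1, hp0, h2, hp2] at hap
    · refine ⟨by_contra fun h1 => ?_, h2⟩
      have htp : t * p₁ ≠ 0 := fun h0 => by simp [h0, h1] at dyy
      have ht0 := left_ne_zero_of_mul htp
      have hp1 := right_ne_zero_of_mul htp
      have hp0 : p₀ = 0 := by simpa [h2, ht0] using dxz
      simp [h2, hp0, h1, hp1] at hap
  obtain ⟨rfl, rfl⟩ := ha12
  have ha0 : a₀ ≠ 0 := by simpa using ha
  have hsp : s * p₂ = 0 := by simpa [hβ] using dzz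
  have htp : t * p₁ = 0 := by simpa [hβ] using dyy
  refine ⟨rfl, rfl, ?_⟩
  by_cases hs0 : s = 0
  · have hc2 : c₂ = 0 := by simpa [hβ, hs0] using hzzz
    have ht0 : t ≠ 0 := by rintro rfl; simp [hs0, ha0] at dxx
    have hc1 : c₁ ≠ 0 := by rintro rfl; simp [hβ, ht0] at hyyy
    have hc0 : c₀ = 0 := by simpa [hβ, hc1] using hxyy
    have hb0 : b₀ = 0 := by simpa [ha0, hc0] using hxxx
    have hb1 : b₁ = 0 := by simpa [hs0, ha0, hc0, hb0] using hs
    exact ⟨hb0, hc0, Or.inr ⟨hb1, hc2⟩⟩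
  · have hp2 : p₂ = 0 := by simpa [hs0] using hsp
    have hp1 : p₁ ≠ 0 := by rintro rfl; simp [hp2, ha0] at dxx
    have ht0 : t = 0 := by simpa [hp1] using htp
    have hc1 : c₁ = 0 := by simpa [hβ, ht0] using hyyy
    have hc2 : c₂ ≠ 0 := by rintro rfl; simp [hβ, hs0] at hzzz
    have hc0 : c₀ = 0 := by simpa [hβ, hc2] using hxzz
    have hb0 : b₀ = 0 := by simpa [ha0, hc0] using hxxx
    have hb2 : b₂ = 0 := by simpa [ht0, ha0, hc0, hb0] using ht
    exact ⟨hb0, hc0, Or.inl ⟨hb2, hc1⟩⟩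

lemma monomial_of_matAct_eq_smul [CharZero K] {β c : K} (hβ : β ≠ 0) (A : GL3 K)
    (h : matAct (A : Matrix (Fin 3) (Fin 3) K) (X 0 ^ 6 + X 1 ^ 5 * X 2 + X 1 * X 2 ^ 5
        + C β * X 0 ^ 2 * X 1 ^ 2 * X 2 ^ 2)
      = c • (X 0 ^ 6 + X 1 ^ 5 * X 2 + X 1 * X 2 ^ 5 + C β * X 0 ^ 2 * X 1 ^ 2 * X 2 ^ 2)) :
    ∃ a b d : K, A.1 = !![a, 0, 0; 0, b, 0; 0, 0, d] ∨ A.1 = !![a, 0, 0; 0, 0, b; 0, d, 0] := by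
  have hentry : ∀ i j, ((A⁻¹ : GL3 K).1 * A.1) i j = (1 : Matrix (Fin 3) (Fin 3) K) i j := by
    simp
  simp only [Matrix.mul_apply, Fin.sum_univ_three] at hentry
  have h00 := hentry 0 0
  have h10 := hentry 1 0
  have h11 := hentry 1 1
  have h12 := hentry 1 2
  simp only [Matrix.one_apply_eq] at h00 h11
  rw [Matrix.one_apply_ne (by decide)] at h10 h12
  have hcol : ∀ j, (fun i => A.1 i j) = ![A.1 0 j, A.1 1 j, A.1 2 j] := fun j => by
    funext i; fin_cases i <;> rfl
  have hcoef := cubic_coeffs_of_apolar hβ (hcol 0) (hcol 1) (hcol 2) (apolar_dirDeriv A h)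
  obtain ⟨ha1, ha2, hb0, hc0, h'⟩ := monomial_of_cubic_coeffs
    (p₀ := (A⁻¹ : GL3 K).1 1 0) (p₁ := (A⁻¹ : GL3 K).1 1 1) (p₂ := (A⁻¹ : GL3 K).1 1 2) hβ
    (by rintro ⟨h0, h1, h2⟩; simp [h0, h1, h2] at h00)
    (by linear_combination h10) (by linear_combination h11) (by linear_combination h12) hcoef
  rcases h' with ⟨hb2, hc1⟩ | ⟨hb1, hc2⟩
  · refine ⟨A.1 0 0, A.1 1 1, A.1 2 2, Or.inl ?_⟩
    ext i j
    fin_cases i <;> fin_cases j <;> simp [ha1, ha2, hb0, hc0, hb2, hc1]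
  · refine ⟨A.1 0 0, A.1 1 2, A.1 2 1, Or.inr ?_⟩
    ext i j
    fin_cases i <;> fin_cases j <;> simp [ha1, ha2, hb0, hc0, hb1, hc2]

lemma eq_smul_of_matAct_diagonal [CharZero K] {β a b d c : K} (hβ : β ≠ 0) (ha : a ≠ 0)
    (h : matAct !![a, 0, 0; 0, b, 0; 0, 0, d] (X 0 ^ 6 + X 1 ^ 5 * X 2 + X 1 * X 2 ^ 5
        + C β * X 0 ^ 2 * X 1 ^ 2 * X 2 ^ 2)
      = c • (X 0 ^ 6 + X 1 ^ 5 * X 2 + X 1 * X 2 ^ 5 + C β * X 0 ^ 2 * X 1 ^ 2 * X 2 ^ 2)) :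
    ∃ u : K, u ^ 8 = 1 ∧ b = a * u ∧ d = a * u ^ 3 := by
  have hE : ∀ x y z : K, a ^ 6 * x ^ 6 + b ^ 5 * d * (y ^ 5 * z) + b * d ^ 5 * (y * z ^ 5)
      + β * (a ^ 2 * b ^ 2 * d ^ 2) * (x ^ 2 * y ^ 2 * z ^ 2)
      = c * (x ^ 6 + y ^ 5 * z + y * z ^ 5 + β * x ^ 2 * y ^ 2 * z ^ 2) := by
    intro x y z
    have := congrArg (eval ![x, y, z]) h
    simp [matAct, Fin.sum_univ_three] at this
    linear_combination this
  have h1 : a ^ 6 = c := by linear_combination hE 1 0 0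
  have h2 : b ^ 5 * d = c := by linear_combination (16 * hE 0 1 1 - hE 0 1 2 / 2) / 15
  have h3 : b * d ^ 5 = c := by linear_combination (hE 0 1 2 / 2 - hE 0 1 1) / 15
  have h4 : a ^ 2 * b ^ 2 * d ^ 2 = c := by
    apply mul_left_cancel₀ hβ
    linear_combination hE 1 1 1 - h1 - h2 - h3
  subst h1
  obtain ⟨u, rfl⟩ : ∃ u, b = a * u := ⟨b / a, by field_simp⟩
  obtain ⟨v, rfl⟩ : ∃ v, d = a * v := ⟨d / a, by field_simp⟩
  have ha6 : a ^ 6 ≠ 0 := pow_ne_zero _ ha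
  have h2' : u ^ 5 * v = 1 := mul_left_cancel₀ ha6 (by linear_combination h2)
  have h4' : u ^ 2 * v ^ 2 = 1 := mul_left_cancel₀ ha6 (by linear_combination h4)
  have huv : v = u ^ 3 := by
    have hu : u ^ 2 * v ≠ 0 := fun h0 => by
      have : u ^ 2 * v ^ 2 = 0 := by linear_combination v * h0
      simp [h4'] at this
    apply mul_left_cancel₀ hu
    linear_combination h4' - h2'
  subst huv
  exact ⟨u, by linear_combination h2', rfl, rfl⟩

lemma pgl_val (A : GL3 K) : pgl A.1 = (QuotientGroup.mk A : PGL3 K) := by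
  have h : A.isUnit.unit = A := Units.ext rfl
  rw [pgl, dif_pos A.isUnit, h]

lemma mk_eq_mk_of_smul {A B : GL3 K} {a : K} (h : A.1 = a • B.1) :
    (QuotientGroup.mk A : PGL3 K) = QuotientGroup.mk B := by
  symm
  rw [QuotientGroup.eq]
  refine Matrix.GeneralLinearGroup.mem_center_iff_val_mem_range_scalar.mpr ⟨a, ?_⟩
  rw [Units.val_mul, h, Matrix.mul_smul, ← Units.val_mul, inv_mul_cancel, Units.val_one,
    Matrix.scalar_apply, Matrix.smul_one_eq_diagonal]

/-- Recognition of the semidihedral group of order `16`. -/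
lemma eq_closure_and_card_of_semidihedral {G : Type*} [Group G] {s t : G} (hs8 : s ^ 8 = 1)
    (hs4 : s ^ 4 ≠ 1) (ht : t ^ 2 = 1) (hts : t * s * t = s ^ 3) {H : Subgroup G} (hsH : s ∈ H)
    (htH : t ∈ H) (hH : ∀ g ∈ H, ∃ i : ℕ, g = s ^ i ∨ g = s ^ i * t) :
    H = Subgroup.closure {s, t} ∧ Nat.card H = 16 := by
  refine ⟨le_antisymm ?_ ?_, ?_⟩
  · intro g hg
    have hs' : s ∈ Subgroup.closure {s, t} := Subgroup.subset_closure (by simp)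
    have ht' : t ∈ Subgroup.closure {s, t} := Subgroup.subset_closure (by simp)
    obtain ⟨i, rfl | rfl⟩ := hH g hg
    · exact pow_mem hs' i
    · exact mul_mem (pow_mem hs' i) ht'
  · rw [Subgroup.closure_le]
    rintro g (rfl | rfl)
    · exact hsH
    · exact htH
  have hord : orderOf s = 8 := orderOf_eq_prime_pow (p := 2) (n := 2) hs4 hs8
  have hne : ∀ m : ℤ, s ^ m ≠ t := by
    rintro m rfl
    have hcomm : s ^ m * s = s * s ^ m := ((Commute.refl s).zpow_left m).eq
    have h2 : s ^ 2 = 1 := by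
      rw [hcomm, mul_assoc, ← pow_two, ht, mul_one, pow_succ', left_eq_mul] at hts
      exact hts
    exact hs4 (by rw [show (4 : ℕ) = 2 * 2 from rfl, pow_mul, h2, one_pow])
  let f : Fin 8 × Fin 2 → H := fun x =>
    ⟨s ^ (x.1 : ℕ) * t ^ (x.2 : ℕ), mul_mem (pow_mem hsH _) (pow_mem htH _)⟩
  have hf : Function.Bijective f := by
    constructor
    · rintro ⟨i, k⟩ ⟨j, l⟩ h
      have h' : s ^ (i : ℕ) * t ^ (k : ℕ) = s ^ (j : ℕ) * t ^ (l : ℕ) := congrArg Subtype.val h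
      have hij : s ^ (i : ℕ) = s ^ (j : ℕ) → i = j := fun e => Fin.ext <|
        pow_injOn_Iio_orderOf (by simp [hord]) (by simp [hord]) e
      fin_cases k <;> fin_cases l <;> simp at h'
      · rw [hij h']
      · refine absurd ?_ (hne (-(j : ℤ) + i))
        rw [zpow_add, zpow_neg, zpow_natCast, zpow_natCast, h', inv_mul_cancel_left]
      · refine absurd ?_ (hne (-(i : ℤ) + j))
        rw [zpow_add, zpow_neg, zpow_natCast, zpow_natCast, ← h', inv_mul_cancel_left]
      · rw [hij h']
    · rintro ⟨g, hg⟩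
      obtain ⟨i, hi⟩ := hH g hg
      have hmod : s ^ (i % 8) = s ^ i := by rw [← hord, pow_mod_orderOf]
      rcases hi with rfl | rfl
      · exact ⟨(⟨i % 8, Nat.mod_lt _ (by norm_num)⟩, 0), Subtype.ext (by simp [f, hmod])⟩
      · exact ⟨(⟨i % 8, Nat.mod_lt _ (by norm_num)⟩, 1), Subtype.ext (by simp [f, hmod])⟩
  rw [← Nat.card_eq_of_bijective f hf]
  simp

/-- For `β ≠ 0` with `X⁶ + Y⁵Z + YZ⁵ + βX²Y²Z²` smooth, the automorphism group
is generated by `σ = diag(1, ζ₈, ζ₈³)` and `τ = [X:Z:Y]`, has order `16` and satisfies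
`σ⁸ = τ² = 1`, `τστ = σ³`; i.e. it is the semidihedral group `SD₁₆`. -/
theorem typeEight_sextic_automorphisms {K : Type*} [Field K] [IsAlgClosed K] [CharZero K]
    (ζ : K) (hζ : IsPrimitiveRoot ζ 8) (β : K) (hβ : β ≠ 0)
    (hsm : IsSmoothSextic (X 0 ^ 6 + X 1 ^ 5 * X 2 + X 1 * X 2 ^ 5
      + C β * X 0 ^ 2 * X 1 ^ 2 * X 2 ^ 2 : MvPolynomial (Fin 3) K)) :
    planeAut (X 0 ^ 6 + X 1 ^ 5 * X 2 + X 1 * X 2 ^ 5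
        + C β * X 0 ^ 2 * X 1 ^ 2 * X 2 ^ 2 : MvPolynomial (Fin 3) K)
      = Subgroup.closure
        {pgl !![1, 0, 0; 0, ζ, 0; 0, 0, ζ ^ 3], pgl !![(1 : K), 0, 0; 0, 0, 1; 0, 1, 0]} ∧
    Nat.card ↥(planeAut (X 0 ^ 6 + X 1 ^ 5 * X 2 + X 1 * X 2 ^ 5
      + C β * X 0 ^ 2 * X 1 ^ 2 * X 2 ^ 2 : MvPolynomial (Fin 3) K)) = 16 ∧
    (pgl !![1, 0, 0; 0, ζ, 0; 0, 0, ζ ^ 3]) ^ 8 = 1 ∧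
    (pgl !![(1 : K), 0, 0; 0, 0, 1; 0, 1, 0]) ^ 2 = 1 ∧
    pgl !![(1 : K), 0, 0; 0, 0, 1; 0, 1, 0] * pgl !![1, 0, 0; 0, ζ, 0; 0, 0, ζ ^ 3] *
        pgl !![(1 : K), 0, 0; 0, 0, 1; 0, 1, 0]
      = (pgl !![1, 0, 0; 0, ζ, 0; 0, 0, ζ ^ 3]) ^ 3 := by
  have hζ8 : ζ ^ 8 = 1 := hζ.pow_eq_one
  have hζ0 : ζ ≠ 0 := hζ.ne_zero (by norm_num)
  set F : MvPolynomial (Fin 3) K := X 0 ^ 6 + X 1 ^ 5 * X 2 + X 1 * X 2 ^ 5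
    + C β * X 0 ^ 2 * X 1 ^ 2 * X 2 ^ 2 with hF
  obtain ⟨S, hS⟩ : IsUnit (!![1, 0, 0; 0, ζ, 0; 0, 0, ζ ^ 3] : Matrix (Fin 3) (Fin 3) K) := by
    rw [Matrix.isUnit_iff_isUnit_det, isUnit_iff_ne_zero]
    simp [Matrix.det_fin_three, hζ0]
  obtain ⟨T, hT⟩ : IsUnit (!![1, 0, 0; 0, 0, 1; 0, 1, 0] : Matrix (Fin 3) (Fin 3) K) := by
    rw [Matrix.isUnit_iff_isUnit_det, isUnit_iff_ne_zero]
    simp [Matrix.det_fin_three]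
  rw [← hS, ← hT, pgl_val, pgl_val]
  have hSpow : ∀ i : ℕ, (S ^ i).1 = !![1, 0, 0; 0, ζ ^ i, 0; 0, 0, (ζ ^ i) ^ 3] := by
    intro i
    have hdiag : S.1 = Matrix.diagonal ![1, ζ, ζ ^ 3] := by
      rw [hS]
      ext i j
      fin_cases i <;> fin_cases j <;> simp
    rw [Units.val_pow_eq_pow_val, hdiag, Matrix.diagonal_pow]
    ext j k
    fin_cases j <;> fin_cases k <;> simp [pow_right_comm]
  have hS8 : S ^ 8 = 1 := by
    apply Units.ext
    rw [hSpow, hζ8]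
    ext i j
    fin_cases i <;> fin_cases j <;> simp
  have hT2 : T ^ 2 = 1 := by
    apply Units.ext
    rw [pow_two, Units.val_mul, hT]
    ext i j
    fin_cases i <;> fin_cases j <;> simp
  have hTST : T * S * T = S ^ 3 := by
    apply Units.ext
    rw [hSpow, Units.val_mul, Units.val_mul, hT, hS]
    have hζ9 : (ζ ^ 3) ^ 3 = ζ := by linear_combination ζ * hζ8
    ext i j
    fin_cases i <;> fin_cases j <;> simp [hζ9]
  have hS4 : (QuotientGroup.mk S : PGL3 K) ^ 4 ≠ 1 := by
    rw [← QuotientGroup.mk_pow, Ne, QuotientGroup.eq_one_iff]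
    intro h
    obtain ⟨a, ha⟩ := Matrix.GeneralLinearGroup.mem_center_iff_val_mem_range_scalar.mp h
    rw [hSpow] at ha
    have h0 := congrFun (congrFun ha 0) 0
    have h1 := congrFun (congrFun ha 1) 1
    simp at h0 h1
    exact hζ.pow_ne_one_of_pos_of_lt (by norm_num) (by norm_num) (h1.symm.trans h0)
  have hSF : matAct S.1 F = F := by
    have hC : (C ζ : MvPolynomial (Fin 3) K) ^ 8 = 1 := by rw [← C_pow, hζ8, C_1]
    simp only [hS, hF, matAct, Fin.sum_univ_three]
    simp
    linear_combination (X 1 ^ 5 * X 2 + X 1 * X 2 ^ 5 * (C ζ ^ 8 + 1)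
      + C β * X 0 ^ 2 * X 1 ^ 2 * X 2 ^ 2) * hC
  have hTF : matAct T.1 F = F := by
    simp only [hT, hF, matAct, Fin.sum_univ_three]
    simp
    ring
  have hdiag : ∀ (A : GL3 K) (a b d c : K), A.1 = !![a, 0, 0; 0, b, 0; 0, 0, d] →
      matAct A.1 F = c • F → ∃ i : ℕ, (QuotientGroup.mk A : PGL3 K) = QuotientGroup.mk S ^ i := by
    intro A a b d c hA h
    have ha : a ≠ 0 := by
      rintro rfl
      have := (Matrix.isUnit_iff_isUnit_det _).mp A.isUnit
      rw [hA] at this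
      simp [Matrix.det_fin_three] at this
    rw [hA] at h
    obtain ⟨u, hu, rfl, rfl⟩ := eq_smul_of_matAct_diagonal hβ ha h
    obtain ⟨i, -, rfl⟩ := hζ.eq_pow_of_pow_eq_one hu
    refine ⟨i, ?_⟩
    rw [← QuotientGroup.mk_pow]
    refine mk_eq_mk_of_smul (a := a) ?_
    rw [hA, hSpow]
    ext j k
    fin_cases j <;> fin_cases k <;> simp
  have hmem : ∀ g ∈ planeAut F, ∃ i : ℕ, g = (QuotientGroup.mk S : PGL3 K) ^ i ∨
      g = (QuotientGroup.mk S : PGL3 K) ^ i * QuotientGroup.mk T := by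
    rintro g ⟨A, rfl, c, -, h⟩
    obtain ⟨a, b, d, hA | hA⟩ := monomial_of_matAct_eq_smul hβ A h
    · obtain ⟨i, hi⟩ := hdiag A a b d c hA h
      exact ⟨i, Or.inl hi⟩
    · have hAT : (A * T).1 = !![a, 0, 0; 0, b, 0; 0, 0, d] := by
        rw [Units.val_mul, hA, hT]
        ext j k
        fin_cases j <;> fin_cases k <;> simp
      obtain ⟨i, hi⟩ := hdiag (A * T) a b d c hAT
        (by rw [Units.val_mul, ← matAct_matAct, h, matAct_smul, hTF])
      refine ⟨i, Or.inr ?_⟩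
      rw [← hi, ← QuotientGroup.mk_mul, mul_assoc, ← pow_two, hT2, mul_one]
  have hs8 : (QuotientGroup.mk S : PGL3 K) ^ 8 = 1 := by
    rw [← QuotientGroup.mk_pow, hS8, QuotientGroup.mk_one]
  have ht2 : (QuotientGroup.mk T : PGL3 K) ^ 2 = 1 := by
    rw [← QuotientGroup.mk_pow, hT2, QuotientGroup.mk_one]
  have hts : (QuotientGroup.mk T : PGL3 K) * QuotientGroup.mk S * QuotientGroup.mk T
      = QuotientGroup.mk S ^ 3 := by
    rw [← QuotientGroup.mk_mul, ← QuotientGroup.mk_mul, hTST, QuotientGroup.mk_pow]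
  obtain ⟨hcl, hcard⟩ := eq_closure_and_card_of_semidihedral hs8 hS4 ht2 hts
    (H := planeAut F) ⟨S, rfl, 1, one_ne_zero, by rw [hSF, one_smul]⟩
    ⟨T, rfl, 1, one_ne_zero, by rw [hTF, one_smul]⟩ hmem
  exact ⟨hcl, hcard, hs8, ht2, hts⟩
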